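/- The maps J^L(x) := g_L^{-1} S(x) g_L and J^R(x) := g_L S^{-1}(x) g_L^{-1} are involutive unital algebra antihomomorphisms of A (J^L(xy) = J^L(y) J^L(x), J^L(1) = 1, J^L ∘ J^L = id, and likewise for J^R), and the functional ω satisfies ω ∘ J = ω ∘ J^L = ω ∘ J^R = ω ∘ S = ω. -/

import Mathlib

open scoped TensorProduct

noncomputable section

/-- An element of a `C*`-algebra is positive iff it is of the form `star y * y`. -/
def IsPosElem {A : Type*} [Mul A] [Star A] (x : A) : Prop := ∃ y : A, x = star y * y

section Helpers

variable {A : Type*} [NormedRing A] [StarRing A] [CStarRing A]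
  [NormedAlgebra ℂ A] [StarModule ℂ A]

/-- Apply a linear functional to the first leg of a tensor (`⟨φ, u₁⟩ u₂`). -/
def lapp (φ : A →ₗ[ℂ] ℂ) : A ⊗[ℂ] A →ₗ[ℂ] A :=
  (TensorProduct.lid ℂ A).toLinearMap ∘ₗ TensorProduct.map φ LinearMap.id

/-- Apply a linear functional to the second leg of a tensor (`⟨φ, u₂⟩ u₁`). -/
def rapp (φ : A →ₗ[ℂ] ℂ) : A ⊗[ℂ] A →ₗ[ℂ] A :=
  (TensorProduct.rid ℂ A).toLinearMap ∘ₗ TensorProduct.map LinearMap.id φ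

/-- Apply a pair of linear functionals to the two legs of a tensor (`⟨φ, u₁⟩⟨ψ, u₂⟩`). -/
def papp (φ ψ : A →ₗ[ℂ] ℂ) : A ⊗[ℂ] A →ₗ[ℂ] ℂ :=
  (TensorProduct.lid ℂ ℂ).toLinearMap ∘ₗ TensorProduct.map φ ψ

end Helpers

/-- A `C*`-weak Hopf algebra: a finite-dimensional unital `C*`-algebra `A` equipped with a
comultiplication `Δ` (written in Sweedler notation `Δ x = x₍₁₎ ⊗ x₍₂₎`), counit `ε` and
antipode `S`, satisfying the axioms of Böhm–Szlachányi.  The field `starT` is the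
(componentwise) star operation on `A ⊗[ℂ] A`, characterized by additivity and its values on
pure tensors. -/
structure WeakHopfData (A : Type*) [NormedRing A] [StarRing A] [CStarRing A]
    [NormedAlgebra ℂ A] [StarModule ℂ A] [FiniteDimensional ℂ A] : Type _ where
  Δ : A →ₗ[ℂ] A ⊗[ℂ] A
  ε : A →ₗ[ℂ] ℂ
  S : A ≃ₗ[ℂ] A
  starT : A ⊗[ℂ] A → A ⊗[ℂ] A
  starT_add : ∀ u v : A ⊗[ℂ] A, starT (u + v) = starT u + starT v
  starT_tmul : ∀ a b : A, starT (a ⊗ₜ[ℂ] b) = star a ⊗ₜ[ℂ] star b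
  /-- coassociativity of the comultiplication -/
  coassoc : (TensorProduct.assoc ℂ A A A).toLinearMap ∘ₗ
      (TensorProduct.map Δ LinearMap.id) ∘ₗ Δ = (TensorProduct.map LinearMap.id Δ) ∘ₗ Δ
  /-- counit axiom, left version -/
  counit_left : (TensorProduct.lid ℂ A).toLinearMap ∘ₗ (TensorProduct.map ε LinearMap.id) ∘ₗ Δ
      = LinearMap.id
  /-- counit axiom, right version -/
  counit_right : (TensorProduct.rid ℂ A).toLinearMap ∘ₗ (TensorProduct.map LinearMap.id ε) ∘ₗ Δ
      = LinearMap.id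
  /-- the comultiplication is multiplicative -/
  Δ_mul : ∀ x y : A, Δ (x * y) = Δ x * Δ y
  /-- the star operation is comultiplicative -/
  Δ_star : ∀ x : A, Δ (star x) = starT (Δ x)
  /-- the unit is weakly comultiplicative:
  `(Δ ⊗ id)(Δ 1) = (Δ 1 ⊗ 1)(1 ⊗ Δ 1)` -/
  Δ_one_weak : (TensorProduct.map Δ LinearMap.id) (Δ 1)
      = (Δ 1 ⊗ₜ[ℂ] (1 : A)) * ((TensorProduct.assoc ℂ A A A).symm ((1 : A) ⊗ₜ[ℂ] Δ 1))
  /-- the unit is weakly comultiplicative: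
  `(Δ ⊗ id)(Δ 1) = (1 ⊗ Δ 1)(Δ 1 ⊗ 1)` -/
  Δ_one_weak' : (TensorProduct.map Δ LinearMap.id) (Δ 1)
      = ((TensorProduct.assoc ℂ A A A).symm ((1 : A) ⊗ₜ[ℂ] Δ 1)) * (Δ 1 ⊗ₜ[ℂ] (1 : A))
  /-- the counit is weakly multiplicative: `ε (x y z) = ε (x y₍₁₎) ε (y₍₂₎ z)` -/
  ε_weak : ∀ x y z : A,
      ε (x * y * z) = papp (ε ∘ₗ LinearMap.mulLeft ℂ x) (ε ∘ₗ LinearMap.mulRight ℂ z) (Δ y)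
  /-- the counit is weakly multiplicative: `ε (x y z) = ε (x y₍₂₎) ε (y₍₁₎ z)` -/
  ε_weak' : ∀ x y z : A,
      ε (x * y * z) = papp (ε ∘ₗ LinearMap.mulRight ℂ z) (ε ∘ₗ LinearMap.mulLeft ℂ x) (Δ y)
  /-- antipode axiom: `x₍₁₎ S(x₍₂₎) = ε (1₍₁₎ x) 1₍₂₎` -/
  antipode_left : ∀ x : A,
      LinearMap.mul' ℂ A ((TensorProduct.map LinearMap.id S.toLinearMap) (Δ x))
        = lapp (ε ∘ₗ LinearMap.mulRight ℂ x) (Δ 1)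
  /-- antipode axiom: `S(x₍₁₎) x₍₂₎ = 1₍₁₎ ε (x 1₍₂₎)` -/
  antipode_right : ∀ x : A,
      LinearMap.mul' ℂ A ((TensorProduct.map S.toLinearMap LinearMap.id) (Δ x))
        = rapp (ε ∘ₗ LinearMap.mulLeft ℂ x) (Δ 1)
  /-- the antipode is antimultiplicative -/
  S_antimul : ∀ x y : A, S (x * y) = S y * S x
  /-- the antipode is anticomultiplicative -/
  S_anticomul : ∀ x : A,
      Δ (S x) = (TensorProduct.comm ℂ A A) ((TensorProduct.map S.toLinearMap S.toLinearMap) (Δ x))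

namespace WeakHopfData

variable {A : Type*} [NormedRing A] [StarRing A] [CStarRing A]
  [NormedAlgebra ℂ A] [StarModule ℂ A] [FiniteDimensional ℂ A]

/-- The source counital map `ε^L (x) = x₍₁₎ S(x₍₂₎)`. -/
def εL (W : WeakHopfData A) : A →ₗ[ℂ] A :=
  LinearMap.mul' ℂ A ∘ₗ TensorProduct.map LinearMap.id W.S.toLinearMap ∘ₗ W.Δ

/-- The target counital map `ε^R (x) = S(x₍₁₎) x₍₂₎`. -/
def εR (W : WeakHopfData A) : A →ₗ[ℂ] A :=
  LinearMap.mul' ℂ A ∘ₗ TensorProduct.map W.S.toLinearMap LinearMap.id ∘ₗ W.Δ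

/-- Full contraction of the iterated coproduct `Δ⁽ⁿ⁾ x = x₍₁₎ ⊗ ⋯ ⊗ x₍ₙ₊₁₎` against a family
of `n+1` linear functionals: `sweedlerEval W n φ x = ⟨φ 0, x₍₁₎⟩ ⋯ ⟨φ n, x₍ₙ₊₁₎⟩`.
Since linear functionals separate the points of a tensor power, identities between iterated
coproducts are faithfully expressed through these contractions. -/
def sweedlerEval (W : WeakHopfData A) : (n : ℕ) → (Fin (n + 1) → (A →ₗ[ℂ] ℂ)) → (A →ₗ[ℂ] ℂ)
  | 0, φ => φ 0
  | n + 1, φ => papp (sweedlerEval W n (Fin.init φ)) (φ (Fin.last (n + 1))) ∘ₗ W.Δ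

end WeakHopfData

/-- A `C*`-weak Hopf algebra together with its canonical distinguished elements:
the Haar integral `h`, the dual Haar integral `hHat`, the square roots `gL`, `gR` of
`E^L h`, `E^R h` (whence the canonical grouplike element `g = gL * gR⁻¹`), real powers
`gLpow`, `gRpow` of `gL` and `gR`, and a positive square root operation `sqrt`;
all characterized by the (uniquely determining) properties listed as fields. -/
structure HaarPkg (A : Type*) [NormedRing A] [StarRing A] [CStarRing A]
    [NormedAlgebra ℂ A] [StarModule ℂ A] [FiniteDimensional ℂ A] : Type _ where
  W : WeakHopfData A
  /-- the Haar integral -/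
  h : A
  haar_left : ∀ x : A, x * h = WeakHopfData.εL W x * h
  haar_right : ∀ x : A, h * x = h * WeakHopfData.εR W x
  haar_counitL : WeakHopfData.εL W h = 1
  haar_counitR : WeakHopfData.εR W h = 1
  haar_idem : h * h = h
  haar_star : star h = h
  haar_S : W.S h = h
  haar_nondeg : ∀ y : A, ∃ φ ψ : A →ₗ[ℂ] ℂ, lapp φ (W.Δ h) = y ∧ rapp ψ (W.Δ h) = y
  /-- the Haar integral of the dual weak Hopf algebra `A*`, as a linear functional on `A` -/
  hHat : A →ₗ[ℂ] ℂ
  hHat_pos : ∀ x : A, ∃ r : ℝ, 0 ≤ r ∧ hHat (star x * x) = (r : ℂ)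
  hHat_S : ∀ x : A, hHat (W.S x) = hHat x
  /-- `gL = (E^L h)^{1/2}` -/
  gL : A
  /-- `gR = (E^R h)^{1/2}` -/
  gR : A
  gL_pos : IsPosElem gL
  gR_pos : IsPosElem gR
  gL_unit : IsUnit gL
  gR_unit : IsUnit gR
  gL_sq : gL * gL = rapp hHat (W.Δ h)
  gR_sq : gR * gR = lapp hHat (W.Δ h)
  gL_mem : gL ∈ Set.range (WeakHopfData.εL W)
  gR_mem : gR ∈ Set.range (WeakHopfData.εR W)
  gR_S : gR = W.S gL
  gLR_comm : gL * gR = gR * gL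
  /-- the canonical grouplike element `g = gL * gR⁻¹` is positive -/
  g_pos : IsPosElem (gL * Ring.inverse gR)
  g_unit : IsUnit (gL * Ring.inverse gR)
  /-- `Δ g = (g ⊗ g) Δ 1` -/
  g_grouplike : W.Δ (gL * Ring.inverse gR)
      = ((gL * Ring.inverse gR) ⊗ₜ[ℂ] (gL * Ring.inverse gR)) * W.Δ 1
  /-- `Δ g = Δ 1 (g ⊗ g)` -/
  g_grouplike' : W.Δ (gL * Ring.inverse gR)
      = W.Δ 1 * ((gL * Ring.inverse gR) ⊗ₜ[ℂ] (gL * Ring.inverse gR))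
  /-- `S g = g⁻¹` -/
  g_S : W.S (gL * Ring.inverse gR) = Ring.inverse (gL * Ring.inverse gR)
  /-- `S² x = g x g⁻¹` -/
  S_sq : ∀ x : A,
      W.S (W.S x) = (gL * Ring.inverse gR) * x * Ring.inverse (gL * Ring.inverse gR)
  /-- `h₍₁₎ ⊗ g h₍₂₎ g = h₍₂₎ ⊗ h₍₁₎` -/
  haar_flip : TensorProduct.map LinearMap.id
      (LinearMap.mulLeft ℂ (gL * Ring.inverse gR) ∘ₗ LinearMap.mulRight ℂ (gL * Ring.inverse gR))
      (W.Δ h) = (TensorProduct.comm ℂ A A) (W.Δ h)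
  /-- dual integral relation `⟨ĥ, x (h gL⁻²)⟩ = ε x` -/
  hHat_dual₁ : ∀ x : A, hHat (x * (h * (Ring.inverse gL * Ring.inverse gL))) = W.ε x
  /-- dual integral relation `⟨ĥ, (gR⁻² h) x⟩ = ε x` -/
  hHat_dual₂ : ∀ x : A, hHat ((Ring.inverse gR * Ring.inverse gR * h) * x) = W.ε x
  /-- dual integral relation `⟨ĥ, (h gL⁻²)₍₂₎⟩ (h gL⁻²)₍₁₎ = 1` -/
  hHat_dual₃ : rapp hHat (W.Δ (h * (Ring.inverse gL * Ring.inverse gL))) = 1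
  /-- dual integral relation `⟨ĥ, (gR⁻² h)₍₁₎⟩ (gR⁻² h)₍₂₎ = 1` -/
  hHat_dual₄ : lapp hHat (W.Δ (Ring.inverse gR * Ring.inverse gR * h)) = 1
  /-- the positive square root, via the continuous functional calculus -/
  sqrt : A → A
  sqrt_pos : ∀ x : A, IsPosElem x → IsPosElem (sqrt x)
  sqrt_mul_self : ∀ x : A, IsPosElem x → sqrt x * sqrt x = x
  /-- real powers of `gL`, via the continuous functional calculus -/
  gLpow : ℝ → A
  /-- real powers of `gR`, via the continuous functional calculus -/
  gRpow : ℝ → A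
  gLpow_one : gLpow 1 = gL
  gRpow_one : gRpow 1 = gR
  gLpow_zero : gLpow 0 = 1
  gRpow_zero : gRpow 0 = 1
  gLpow_add : ∀ s t : ℝ, gLpow (s + t) = gLpow s * gLpow t
  gRpow_add : ∀ s t : ℝ, gRpow (s + t) = gRpow s * gRpow t
  gLpow_pos : ∀ t : ℝ, IsPosElem (gLpow t)
  gRpow_pos : ∀ t : ℝ, IsPosElem (gRpow t)
  gLpow_continuous : Continuous gLpow
  gRpow_continuous : Continuous gRpow

namespace HaarPkg

variable {A : Type*} [NormedRing A] [StarRing A] [CStarRing A]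
  [NormedAlgebra ℂ A] [StarModule ℂ A] [FiniteDimensional ℂ A]
variable (P : HaarPkg A)

/-- The canonical grouplike element `g = gL gR⁻¹`. -/
def g : A := P.gL * Ring.inverse P.gR

/-- The Watatani index `ı = ε^L (h gL⁻²)` of the Haar conditional expectations. -/
def iotaEl : A := WeakHopfData.εL P.W (P.h * (Ring.inverse P.gL * Ring.inverse P.gL))

/-- The element `ȷ = ⟨ĥ, (gL⁻²)₍₁₎⟩ (gL⁻²)₍₂₎`, the dual analogue of the Watatani index. -/
def jayEl : A := lapp P.hHat (P.W.Δ (Ring.inverse P.gL * Ring.inverse P.gL))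

/-- The pulling-through element `Ω = ı⁻¹ gL⁻¹ h gL⁻¹`. -/
def Ω : A := Ring.inverse P.iotaEl * Ring.inverse P.gL * P.h * Ring.inverse P.gL

/-- The map `J x = g^{-1/2} S(x) g^{1/2}`, as a linear map. -/
def Jlin : A →ₗ[ℂ] A :=
  LinearMap.mulRight ℂ (P.sqrt P.g) ∘ₗ
    LinearMap.mulLeft ℂ (Ring.inverse (P.sqrt P.g)) ∘ₗ P.W.S.toLinearMap

/-- The functional `⟨ω, x⟩ = ⟨ĥ, ȷ⁻¹ gL⁻¹ gR⁻¹ x⟩` (the dual analogue of `Ω`). -/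
def ω : A →ₗ[ℂ] ℂ :=
  P.hHat ∘ₗ LinearMap.mulLeft ℂ (Ring.inverse P.jayEl * (Ring.inverse P.gL * Ring.inverse P.gR))

/-- `ξ_L = ı^{1/2} ȷ^{1/2} gL`. -/
def ξL : A := P.sqrt P.iotaEl * P.sqrt P.jayEl * P.gL

/-- `ξ_R = ı^{1/2} ȷ^{1/2} gR`. -/
def ξR : A := P.sqrt P.iotaEl * P.sqrt P.jayEl * P.gR

/-- `ξ = ξ_L ξ_R`. -/
def ξ : A := P.ξL * P.ξR

/-- `J^L x = gL⁻¹ S(x) gL`. -/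
def JL : A → A := fun x => Ring.inverse P.gL * P.W.S x * P.gL

/-- `J^R x = gL S⁻¹(x) gL⁻¹`. -/
def JR : A → A := fun x => P.gL * P.W.S.symm x * Ring.inverse P.gL

end HaarPkg

section TensorContractions

variable {A : Type*} [NormedRing A] [NormedAlgebra ℂ A]

@[simp]
theorem lapp_tmul (φ : A →ₗ[ℂ] ℂ) (x y : A) : lapp φ (x ⊗ₜ[ℂ] y) = φ x • y := by
  simp [lapp]

@[simp]
theorem rapp_tmul (φ : A →ₗ[ℂ] ℂ) (x y : A) : rapp φ (x ⊗ₜ[ℂ] y) = φ y • x := by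
  simp [rapp]

@[simp]
theorem papp_tmul (φ ψ : A →ₗ[ℂ] ℂ) (x y : A) : papp φ ψ (x ⊗ₜ[ℂ] y) = φ x * ψ y := by
  simp [papp]

theorem lapp_comp_mulLeft (φ : A →ₗ[ℂ] ℂ) (x : A) (t : A ⊗[ℂ] A) :
    lapp (φ ∘ₗ LinearMap.mulLeft ℂ x) t = lapp φ ((x ⊗ₜ[ℂ] 1) * t) := by
  induction t using TensorProduct.induction_on with
  | zero => simp
  | tmul p q => simp
  | add s t hs ht => simp only [map_add, mul_add, hs, ht]

theorem lapp_comp_mulRight (φ : A →ₗ[ℂ] ℂ) (x : A) (t : A ⊗[ℂ] A) :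
    lapp (φ ∘ₗ LinearMap.mulRight ℂ x) t = lapp φ (t * (x ⊗ₜ[ℂ] 1)) := by
  induction t using TensorProduct.induction_on with
  | zero => simp
  | tmul p q => simp
  | add s t hs ht => simp only [map_add, add_mul, hs, ht]

theorem rapp_comp_mulLeft (φ : A →ₗ[ℂ] ℂ) (x : A) (t : A ⊗[ℂ] A) :
    rapp (φ ∘ₗ LinearMap.mulLeft ℂ x) t = rapp φ ((1 ⊗ₜ[ℂ] x) * t) := by
  induction t using TensorProduct.induction_on with
  | zero => simp
  | tmul p q => simp
  | add s t hs ht => simp only [map_add, mul_add, hs, ht]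

theorem lapp_mul_one_tmul (φ : A →ₗ[ℂ] ℂ) (t : A ⊗[ℂ] A) (x : A) :
    lapp φ (t * (1 ⊗ₜ[ℂ] x)) = lapp φ t * x := by
  induction t using TensorProduct.induction_on with
  | zero => simp
  | tmul p q => simp
  | add s t hs ht => simp only [map_add, add_mul, hs, ht]

theorem lapp_one_tmul_mul (φ : A →ₗ[ℂ] ℂ) (x : A) (t : A ⊗[ℂ] A) :
    lapp φ ((1 ⊗ₜ[ℂ] x) * t) = x * lapp φ t := by
  induction t using TensorProduct.induction_on with
  | zero => simp
  | tmul p q => simp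
  | add s t hs ht => simp only [map_add, mul_add, hs, ht]

theorem rapp_tmul_one_mul (φ : A →ₗ[ℂ] ℂ) (x : A) (t : A ⊗[ℂ] A) :
    rapp φ ((x ⊗ₜ[ℂ] 1) * t) = x * rapp φ t := by
  induction t using TensorProduct.induction_on with
  | zero => simp
  | tmul p q => simp
  | add s t hs ht => simp only [map_add, mul_add, hs, ht]

end TensorContractions

namespace WeakHopfData

variable {A : Type*} [NormedRing A] [StarRing A] [CStarRing A]
  [NormedAlgebra ℂ A] [StarModule ℂ A] [FiniteDimensional ℂ A] (W : WeakHopfData A)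

theorem Δ_one_mul (x : A) : W.Δ 1 * W.Δ x = W.Δ x := by rw [← W.Δ_mul, one_mul]

theorem Δ_mul_one (x : A) : W.Δ x * W.Δ 1 = W.Δ x := by rw [← W.Δ_mul, mul_one]

theorem S_one : W.S 1 = 1 := by
  obtain ⟨y, hy⟩ := W.S.surjective 1
  have h := W.S_antimul y 1
  rwa [mul_one, hy, mul_one, eq_comm] at h

theorem lapp_ε_Δ (x : A) : lapp W.ε (W.Δ x) = x :=
  LinearMap.congr_fun W.counit_left x

theorem rapp_ε_Δ (x : A) : rapp W.ε (W.Δ x) = x :=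
  LinearMap.congr_fun W.counit_right x

theorem assoc_map_Δ (x : A) :
    TensorProduct.assoc ℂ A A A (TensorProduct.map W.Δ LinearMap.id (W.Δ x))
      = TensorProduct.map LinearMap.id W.Δ (W.Δ x) :=
  LinearMap.congr_fun W.coassoc x

theorem εL_apply (x : A) : W.εL x = lapp W.ε (W.Δ 1 * (x ⊗ₜ[ℂ] 1)) := by
  rw [← lapp_comp_mulRight, ← W.antipode_left]; rfl

theorem εR_apply (x : A) : W.εR x = rapp W.ε ((1 ⊗ₜ[ℂ] x) * W.Δ 1) := by
  rw [← rapp_comp_mulLeft, ← W.antipode_right]; rfl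

theorem εL_one : W.εL 1 = 1 := by
  rw [εL_apply, ← Algebra.TensorProduct.one_def, mul_one, lapp_ε_Δ]

/-- `ε^R(a₍₁₎) ⊗ a₍₂₎ = 1₍₁₎ ⊗ a 1₍₂₎`. -/
theorem map_εR_id_Δ (a : A) :
    TensorProduct.map W.εR LinearMap.id (W.Δ a) = (1 ⊗ₜ[ℂ] a) * W.Δ 1 := by
  have key : ∀ d t' : A ⊗[ℂ] A, TensorProduct.map LinearMap.id
      (lapp W.ε ∘ₗ LinearMap.mul ℂ _ d) (TensorProduct.assoc ℂ A A A
        ((TensorProduct.assoc ℂ A A A).symm (1 ⊗ₜ[ℂ] t') * (W.Δ 1 ⊗ₜ[ℂ] 1)))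
      = TensorProduct.map W.εR LinearMap.id (d * t') := by
    intro d t'
    induction d using TensorProduct.induction_on with
    | zero => simp
    | add x y hx hy =>
      simp only [add_mul, map_add, ← hx, ← hy, LinearMap.comp_add, TensorProduct.map_add_right,
        LinearMap.add_apply]
    | tmul d₁ d₂ =>
      induction t' using TensorProduct.induction_on with
      | zero => simp
      | add x y hx hy => simp only [mul_add, add_mul, map_add, TensorProduct.tmul_add, hx, hy]
      | tmul p q =>
        simp only [Algebra.TensorProduct.tmul_mul_tmul, TensorProduct.map_tmul, εR_apply]
        induction W.Δ 1 using TensorProduct.induction_on with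
        | zero => simp
        | add x y hx hy =>
          simp only [mul_add, map_add, TensorProduct.add_tmul, hx, hy]
        | tmul r s => simp [mul_assoc, TensorProduct.smul_tmul]
  have h2 : ∀ t : A ⊗[ℂ] A, TensorProduct.map LinearMap.id
      (lapp W.ε ∘ₗ LinearMap.mul ℂ _ (W.Δ a)) (TensorProduct.map LinearMap.id W.Δ t)
      = (1 ⊗ₜ[ℂ] a) * t := by
    intro t
    induction t using TensorProduct.induction_on with
    | zero => simp
    | add x y hx hy => simp only [mul_add, map_add, hx, hy]
    | tmul p q => simp [← Δ_mul, lapp_ε_Δ]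
  have h3 := key (W.Δ a) (W.Δ 1)
  rw [Δ_mul_one, ← W.Δ_one_weak', assoc_map_Δ, h2] at h3
  exact h3.symm

/-- `a₍₁₎ ⊗ ε^L(a₍₂₎) = 1₍₁₎ a ⊗ 1₍₂₎`. -/
theorem map_id_εL_Δ (a : A) :
    TensorProduct.map LinearMap.id W.εL (W.Δ a) = W.Δ 1 * (a ⊗ₜ[ℂ] 1) := by
  have key : ∀ t d : A ⊗[ℂ] A, TensorProduct.map
      (rapp W.ε ∘ₗ (LinearMap.mul ℂ _).flip d) LinearMap.id
        ((TensorProduct.assoc ℂ A A A).symm (1 ⊗ₜ[ℂ] W.Δ 1) * (t ⊗ₜ[ℂ] 1))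
      = TensorProduct.map LinearMap.id W.εL (t * d) := by
    intro t d
    induction d using TensorProduct.induction_on with
    | zero => simp
    | add x y hx hy =>
      simp only [mul_add, map_add, ← hx, ← hy, LinearMap.comp_add, TensorProduct.map_add_left,
        LinearMap.add_apply]
    | tmul d₁ d₂ =>
      induction t using TensorProduct.induction_on with
      | zero => simp
      | add x y hx hy => simp only [mul_add, add_mul, map_add, TensorProduct.add_tmul, hx, hy]
      | tmul p q =>
        simp only [Algebra.TensorProduct.tmul_mul_tmul, TensorProduct.map_tmul, εL_apply]
        induction W.Δ 1 using TensorProduct.induction_on with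
        | zero => simp
        | add x y hx hy =>
          simp only [add_mul, map_add, TensorProduct.tmul_add, hx, hy]
        | tmul r s => simp [mul_assoc, TensorProduct.smul_tmul]
  have h2 : ∀ t : A ⊗[ℂ] A, TensorProduct.map
      (rapp W.ε ∘ₗ (LinearMap.mul ℂ _).flip (W.Δ a)) LinearMap.id
        (TensorProduct.map W.Δ LinearMap.id t) = t * (a ⊗ₜ[ℂ] 1) := by
    intro t
    induction t using TensorProduct.induction_on with
    | zero => simp
    | add x y hx hy => simp only [add_mul, map_add, hx, hy]
    | tmul p q => simp [← Δ_mul, rapp_ε_Δ]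
  have h3 := key (W.Δ 1) (W.Δ a)
  rw [Δ_one_mul, ← W.Δ_one_weak', h2] at h3
  exact h3.symm

/-- `ε^L(1₍₁₎) ⊗ 1₍₂₎ = S(1₍₁₎) ⊗ 1₍₂₎`. -/
theorem map_εL_id_Δ_one :
    TensorProduct.map W.εL LinearMap.id (W.Δ 1)
      = TensorProduct.map W.S.toLinearMap LinearMap.id (W.Δ 1) := by
  set m := LinearMap.mul' ℂ A ∘ₗ TensorProduct.map LinearMap.id W.S.toLinearMap with hm
  have key : ∀ t t' : A ⊗[ℂ] A, TensorProduct.map m LinearMap.id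
        ((TensorProduct.assoc ℂ A A A).symm (1 ⊗ₜ[ℂ] t') * (t ⊗ₜ[ℂ] 1))
      = (m t ⊗ₜ[ℂ] 1) * TensorProduct.map W.S.toLinearMap LinearMap.id t' := by
    intro t t'
    induction t using TensorProduct.induction_on with
    | zero => simp
    | add x y hx hy => simp only [mul_add, add_mul, map_add, TensorProduct.add_tmul, hx, hy]
    | tmul p q =>
      induction t' using TensorProduct.induction_on with
      | zero => simp
      | add x y hx hy => simp only [mul_add, add_mul, map_add, TensorProduct.tmul_add, hx, hy]
      | tmul r s => simp [hm, mul_assoc, W.S_antimul]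
  have h3 := key (W.Δ 1) (W.Δ 1)
  have h4 : m (W.Δ 1) = 1 := W.εL_one
  rw [← W.Δ_one_weak', h4, ← Algebra.TensorProduct.one_def, one_mul] at h3
  rw [← h3, ← LinearMap.comp_apply (TensorProduct.map m LinearMap.id), ← TensorProduct.map_comp]
  rfl

/-- `ε(y a₍₁₎) a₍₂₎ = ε(y 1₍₁₎) 1₍₂₎ a`. -/
theorem lapp_ε_tmul_one_mul_Δ (y a : A) :
    lapp W.ε ((y ⊗ₜ[ℂ] 1) * W.Δ a) = lapp W.ε ((y ⊗ₜ[ℂ] 1) * W.Δ 1) * a := by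
  set Ξ := (TensorProduct.lid ℂ A).toLinearMap ∘ₗ TensorProduct.map (W.ε ∘ₗ LinearMap.mulLeft ℂ y)
    (lapp W.ε ∘ₗ (LinearMap.mul ℂ _).flip (W.Δ a)) with hΞ
  have h1 : ∀ t : A ⊗[ℂ] A, Ξ (TensorProduct.map LinearMap.id W.Δ t)
      = lapp W.ε ((y ⊗ₜ[ℂ] 1) * t) * a := by
    intro t
    induction t using TensorProduct.induction_on with
    | zero => simp
    | add x y hx hy => simp only [add_mul, mul_add, map_add, hx, hy]
    | tmul p q => simp [hΞ, ← Δ_mul, lapp_ε_Δ]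
  have h2 : ∀ t t' : A ⊗[ℂ] A, Ξ (TensorProduct.assoc ℂ A A A ((t ⊗ₜ[ℂ] 1) *
      (TensorProduct.assoc ℂ A A A).symm (1 ⊗ₜ[ℂ] t')))
      = (TensorProduct.lid ℂ A) (TensorProduct.map (W.ε ∘ₗ LinearMap.mulLeft ℂ y)
        (lapp W.ε ∘ₗ (LinearMap.mul ℂ _).flip (t' * W.Δ a) ∘ₗ
          (TensorProduct.mk ℂ A A).flip 1) t) := by
    intro t t'
    induction t using TensorProduct.induction_on with
    | zero => simp
    | add x y hx hy => simp only [add_mul, map_add, TensorProduct.add_tmul, hx, hy]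
    | tmul p q =>
      induction t' using TensorProduct.induction_on with
      | zero => simp
      | add x y hx hy =>
        simp only [mul_add, map_add, TensorProduct.tmul_add, hx, hy, add_mul, LinearMap.comp_add,
          LinearMap.add_comp, TensorProduct.map_add_right, LinearMap.add_apply]
      | tmul r s => simp [hΞ, ← mul_assoc]
  have h3 : ∀ t d : A ⊗[ℂ] A, (TensorProduct.lid ℂ A)
      (TensorProduct.map (W.ε ∘ₗ LinearMap.mulLeft ℂ y)
        (lapp W.ε ∘ₗ (LinearMap.mul ℂ _).flip d ∘ₗ (TensorProduct.mk ℂ A A).flip 1) t)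
      = (TensorProduct.lid ℂ A) (TensorProduct.map ((LinearMap.mul' ℂ ℂ) ∘ₗ
        TensorProduct.map (W.ε ∘ₗ LinearMap.mulLeft ℂ y) W.ε) LinearMap.id
          ((t ⊗ₜ[ℂ] 1) * (TensorProduct.assoc ℂ A A A).symm (1 ⊗ₜ[ℂ] d))) := by
    intro t d
    induction t using TensorProduct.induction_on with
    | zero => simp
    | add x y hx hy => simp only [add_mul, map_add, TensorProduct.add_tmul, hx, hy]
    | tmul p q =>
      induction d using TensorProduct.induction_on with
      | zero => simp
      | add x y hx hy =>
        simp only [mul_add, map_add, TensorProduct.tmul_add, hx, hy, LinearMap.comp_add,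
          LinearMap.add_comp, TensorProduct.map_add_right, LinearMap.add_apply]
      | tmul r s => simp [smul_smul, mul_comm (W.ε (q * r))]
  have h4 : ∀ d : A ⊗[ℂ] A, (TensorProduct.lid ℂ A) (TensorProduct.map ((LinearMap.mul' ℂ ℂ) ∘ₗ
        TensorProduct.map (W.ε ∘ₗ LinearMap.mulLeft ℂ y) W.ε) LinearMap.id
          ((W.Δ 1 ⊗ₜ[ℂ] 1) * (TensorProduct.assoc ℂ A A A).symm (1 ⊗ₜ[ℂ] d)))
      = lapp W.ε ((y ⊗ₜ[ℂ] 1) * d) := by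
    intro d
    induction d using TensorProduct.induction_on with
    | zero => simp
    | add x y hx hy =>
      simp only [mul_add, map_add, TensorProduct.tmul_add, hx, hy]
    | tmul r s =>
      have := W.ε_weak y 1 r
      rw [mul_one] at this
      simp only [Algebra.TensorProduct.tmul_mul_tmul, one_mul, lapp_tmul, this]
      induction W.Δ 1 using TensorProduct.induction_on with
      | zero => simp
      | add x y hx hy =>
        simp only [add_mul, map_add, TensorProduct.add_tmul, hx, hy, add_smul]
      | tmul p q => simp
  rw [← h1, ← W.assoc_map_Δ, W.Δ_one_weak, h2, Δ_one_mul, h3, h4]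

/-- `ε^L(a₍₁₎) ⊗ a₍₂₎ = S(1₍₁₎) ⊗ 1₍₂₎ a`. -/
theorem map_εL_id_Δ (a : A) :
    TensorProduct.map W.εL LinearMap.id (W.Δ a)
      = TensorProduct.map W.S.toLinearMap LinearMap.id (W.Δ 1) * (1 ⊗ₜ[ℂ] a) := by
  have key : ∀ d : A ⊗[ℂ] A, TensorProduct.map W.εL LinearMap.id d
      = TensorProduct.comm ℂ A A (TensorProduct.map (lapp W.ε ∘ₗ
        (LinearMap.mul ℂ _).flip d ∘ₗ (TensorProduct.mk ℂ A A).flip 1) LinearMap.id (W.Δ 1)) := by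
    intro d
    induction d using TensorProduct.induction_on with
    | zero => simp
    | add x y hx hy =>
      simp only [map_add, hx, hy, LinearMap.comp_add, LinearMap.add_comp,
        TensorProduct.map_add_left, LinearMap.add_apply]
    | tmul r s =>
      simp only [TensorProduct.map_tmul, εL_apply]
      induction W.Δ 1 using TensorProduct.induction_on with
      | zero => simp
      | add x y hx hy => simp only [add_mul, map_add, TensorProduct.add_tmul, hx, hy]
      | tmul p q => simp [TensorProduct.smul_tmul]
  have h2 : ∀ t : A ⊗[ℂ] A, TensorProduct.comm ℂ A A (TensorProduct.map (lapp W.ε ∘ₗ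
        (LinearMap.mul ℂ _).flip (W.Δ a) ∘ₗ (TensorProduct.mk ℂ A A).flip 1) LinearMap.id t)
      = TensorProduct.comm ℂ A A (TensorProduct.map (lapp W.ε ∘ₗ
        (LinearMap.mul ℂ _).flip (W.Δ 1) ∘ₗ (TensorProduct.mk ℂ A A).flip 1) LinearMap.id t)
        * (1 ⊗ₜ[ℂ] a) := by
    intro t
    induction t using TensorProduct.induction_on with
    | zero => simp
    | add x y hx hy => simp only [add_mul, map_add, hx, hy]
    | tmul p q => simp [W.lapp_ε_tmul_one_mul_Δ p a]
  rw [← map_εL_id_Δ_one, key, h2, ← key]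

/-- `S(a₍₁₎) a₍₂₎ ⊗ a₍₃₎ = 1₍₁₎ ⊗ a 1₍₂₎`, as a contraction of the iterated coproduct. -/
theorem lift_S_map_id_Δ (a : A) :
    TensorProduct.lift ((LinearMap.mul ℂ (A ⊗[ℂ] A)) ∘ₗ (TensorProduct.mk ℂ A A).flip 1 ∘ₗ
      W.S.toLinearMap) (TensorProduct.map LinearMap.id W.Δ (W.Δ a)) = (1 ⊗ₜ[ℂ] a) * W.Δ 1 := by
  rw [← map_εR_id_Δ, ← W.assoc_map_Δ]
  induction W.Δ a using TensorProduct.induction_on with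
  | zero => simp
  | add x y hx hy => simp only [map_add, hx, hy]
  | tmul p q =>
    simp only [TensorProduct.map_tmul, εR, LinearMap.comp_apply]
    induction W.Δ p using TensorProduct.induction_on with
    | zero => simp
    | add x y hx hy => simp only [map_add, TensorProduct.add_tmul, hx, hy]
    | tmul r s => simp

/-- If `z h = ε^L(z) h` for all `z`, then `h₍₁₎ ⊗ x h₍₂₎ = S(x) h₍₁₎ ⊗ h₍₂₎`. -/
theorem one_tmul_mul_Δ_of_left_integral {h : A} (hh : ∀ z : A, z * h = W.εL z * h) (x : A) :
    (1 ⊗ₜ[ℂ] x) * W.Δ h = (W.S x ⊗ₜ[ℂ] 1) * W.Δ h := by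
  set Γ := TensorProduct.lift ((LinearMap.mul ℂ (A ⊗[ℂ] A)) ∘ₗ (TensorProduct.mk ℂ A A).flip 1 ∘ₗ
      W.S.toLinearMap) with hΓ
  have h1 : ∀ t : A ⊗[ℂ] A, Γ (TensorProduct.map LinearMap.id W.Δ t) * W.Δ h
      = Γ (TensorProduct.map LinearMap.id W.Δ
        (TensorProduct.map LinearMap.id (LinearMap.mulRight ℂ h) t)) := by
    intro t
    induction t using TensorProduct.induction_on with
    | zero => simp
    | add x y hx hy => simp only [add_mul, map_add, hx, hy]
    | tmul p q => simp [hΓ, Δ_mul, mul_assoc]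
  have h2 : ∀ t : A ⊗[ℂ] A, TensorProduct.map LinearMap.id (LinearMap.mulRight ℂ h) t
      = TensorProduct.map LinearMap.id (LinearMap.mulRight ℂ h)
        (TensorProduct.map LinearMap.id W.εL t) := by
    intro t
    induction t using TensorProduct.induction_on with
    | zero => simp
    | add x y hx hy => simp only [map_add, hx, hy]
    | tmul p q => simp [hh q]
  have h3 : ∀ t : A ⊗[ℂ] A, Γ (TensorProduct.map LinearMap.id W.Δ (t * (x ⊗ₜ[ℂ] 1)))
      = (W.S x ⊗ₜ[ℂ] 1) * Γ (TensorProduct.map LinearMap.id W.Δ t) := by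
    intro t
    induction t using TensorProduct.induction_on with
    | zero => simp
    | add x y hx hy => simp only [add_mul, mul_add, map_add, hx, hy]
    | tmul p q => simp [hΓ, W.S_antimul, ← mul_assoc]
  have h4 := h1 (W.Δ x)
  rw [h2, map_id_εL_Δ, ← h1, h3, lift_S_map_id_Δ, lift_S_map_id_Δ, mul_assoc, Δ_one_mul,
    ← Algebra.TensorProduct.one_def, one_mul, mul_assoc, Δ_one_mul] at h4
  exact h4

/-- Elements `y` of `A^L` satisfy `Δ(y) = (y ⊗ 1) Δ(1)`. -/
theorem Δ_εL (b : A) : W.Δ (W.εL b) = (W.εL b ⊗ₜ[ℂ] 1) * W.Δ 1 := by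
  have h1 : ∀ t : A ⊗[ℂ] A, W.Δ (lapp W.ε (t * (b ⊗ₜ[ℂ] 1))) =
      TensorProduct.lid ℂ (A ⊗[ℂ] A) (TensorProduct.map (W.ε ∘ₗ LinearMap.mulRight ℂ b)
        LinearMap.id (TensorProduct.map LinearMap.id W.Δ t)) := by
    intro t
    induction t using TensorProduct.induction_on with
    | zero => simp
    | add x y hx hy => simp only [add_mul, map_add, hx, hy]
    | tmul p q => simp
  have h2 : ∀ t t' : A ⊗[ℂ] A, TensorProduct.lid ℂ (A ⊗[ℂ] A)
      (TensorProduct.map (W.ε ∘ₗ LinearMap.mulRight ℂ b) LinearMap.id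
        (TensorProduct.assoc ℂ A A A ((t ⊗ₜ[ℂ] 1) *
          (TensorProduct.assoc ℂ A A A).symm (1 ⊗ₜ[ℂ] t'))))
      = (lapp W.ε (t * (b ⊗ₜ[ℂ] 1)) ⊗ₜ[ℂ] 1) * t' := by
    intro t t'
    induction t using TensorProduct.induction_on with
    | zero => simp
    | add x y hx hy => simp only [add_mul, map_add, TensorProduct.add_tmul, hx, hy]
    | tmul p q =>
      induction t' using TensorProduct.induction_on with
      | zero => simp
      | add x y hx hy => simp only [mul_add, map_add, TensorProduct.tmul_add, hx, hy]
      | tmul r s => simp [TensorProduct.smul_tmul']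
  rw [εL_apply, h1, ← W.assoc_map_Δ, W.Δ_one_weak, h2]

/-- Elements `y` of `A^L` satisfy `Δ(y) = Δ(1) (y ⊗ 1)`. -/
theorem Δ_εL' (b : A) : W.Δ (W.εL b) = W.Δ 1 * (W.εL b ⊗ₜ[ℂ] 1) := by
  have h1 : ∀ t : A ⊗[ℂ] A, W.Δ (lapp W.ε (t * (b ⊗ₜ[ℂ] 1))) =
      TensorProduct.lid ℂ (A ⊗[ℂ] A) (TensorProduct.map (W.ε ∘ₗ LinearMap.mulRight ℂ b)
        LinearMap.id (TensorProduct.map LinearMap.id W.Δ t)) := by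
    intro t
    induction t using TensorProduct.induction_on with
    | zero => simp
    | add x y hx hy => simp only [add_mul, map_add, hx, hy]
    | tmul p q => simp
  have h2 : ∀ t t' : A ⊗[ℂ] A, TensorProduct.lid ℂ (A ⊗[ℂ] A)
      (TensorProduct.map (W.ε ∘ₗ LinearMap.mulRight ℂ b) LinearMap.id
        (TensorProduct.assoc ℂ A A A (
          (TensorProduct.assoc ℂ A A A).symm (1 ⊗ₜ[ℂ] t') * (t ⊗ₜ[ℂ] 1))))
      = t' * (lapp W.ε (t * (b ⊗ₜ[ℂ] 1)) ⊗ₜ[ℂ] 1) := by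
    intro t t'
    induction t using TensorProduct.induction_on with
    | zero => simp
    | add x y hx hy => simp only [mul_add, add_mul, map_add, TensorProduct.add_tmul, hx, hy]
    | tmul p q =>
      induction t' using TensorProduct.induction_on with
      | zero => simp
      | add x y hx hy => simp only [add_mul, map_add, TensorProduct.tmul_add, hx, hy]
      | tmul r s => simp [TensorProduct.smul_tmul']
  rw [εL_apply, h1, ← W.assoc_map_Δ, W.Δ_one_weak', h2]

theorem S_symm_mul (x y : A) : W.S.symm (x * y) = W.S.symm y * W.S.symm x := by
  rw [LinearEquiv.symm_apply_eq, W.S_antimul, LinearEquiv.apply_symm_apply,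
    LinearEquiv.apply_symm_apply]

theorem S_symm_one : W.S.symm 1 = 1 := by rw [LinearEquiv.symm_apply_eq, S_one]

theorem isUnit_S {x : A} (hx : IsUnit x) : IsUnit (W.S x) := by
  obtain ⟨a, rfl⟩ := hx
  exact ⟨⟨W.S a, W.S ↑a⁻¹, by rw [← W.S_antimul, Units.inv_mul, S_one],
    by rw [← W.S_antimul, Units.mul_inv, S_one]⟩, rfl⟩

theorem S_inverse {x : A} (hx : IsUnit x) : W.S (Ring.inverse x) = Ring.inverse (W.S x) := by
  rw [← one_mul (Ring.inverse (W.S x)), Ring.eq_mul_inverse_iff_mul_eq _ _ _ (W.isUnit_S hx),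
    ← W.S_antimul, Ring.mul_inverse_cancel x hx, S_one]

end WeakHopfData

namespace HaarPkg

variable {A : Type*} [NormedRing A] [StarRing A] [CStarRing A]
  [NormedAlgebra ℂ A] [StarModule ℂ A] [FiniteDimensional ℂ A] (P : HaarPkg A)

theorem gL_mul_inv : P.gL * Ring.inverse P.gL = 1 := Ring.mul_inverse_cancel _ P.gL_unit

theorem inv_mul_gL : Ring.inverse P.gL * P.gL = 1 := Ring.inverse_mul_cancel _ P.gL_unit

theorem gR_mul_inv : P.gR * Ring.inverse P.gR = 1 := Ring.mul_inverse_cancel _ P.gR_unit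

theorem inv_mul_gR : Ring.inverse P.gR * P.gR = 1 := Ring.inverse_mul_cancel _ P.gR_unit

theorem commute_gL_gR : Commute P.gL P.gR := P.gLR_comm

theorem commute_inv_gL_gR : Commute (Ring.inverse P.gL) P.gR := by
  obtain ⟨a, ha⟩ := P.gL_unit
  have := P.commute_gL_gR
  rw [← ha] at this ⊢
  rw [Ring.inverse_unit]
  exact this.units_inv_left

theorem commute_gL_inv_gR : Commute P.gL (Ring.inverse P.gR) := by
  obtain ⟨a, ha⟩ := P.gR_unit
  have := P.commute_gL_gR
  rw [← ha] at this ⊢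
  rw [Ring.inverse_unit]
  exact this.units_inv_right

theorem commute_inv_gL_inv_gR : Commute (Ring.inverse P.gL) (Ring.inverse P.gR) :=
  P.commute_gL_gR.ringInverse_ringInverse

theorem inverse_gL_mul_inverse_gR :
    Ring.inverse (P.gL * Ring.inverse P.gR) = P.gR * Ring.inverse P.gL := by
  rw [Ring.mul_inverse_rev' P.commute_gL_inv_gR, Ring.inverse_inverse P.gR_unit]

theorem S_S_apply (x : A) : P.W.S (P.W.S x)
    = P.gL * Ring.inverse P.gR * x * (P.gR * Ring.inverse P.gL) := by
  rw [P.S_sq, inverse_gL_mul_inverse_gR]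

theorem S_gR : P.W.S P.gR = P.gL := by
  rw [P.gR_S, S_S_apply, mul_assoc P.gL, ← P.commute_gL_inv_gR.eq, mul_assoc P.gL,
    mul_assoc P.gL, ← mul_assoc (Ring.inverse P.gR), P.inv_mul_gR, one_mul, P.gL_mul_inv, mul_one]

theorem S_inv_gL : P.W.S (Ring.inverse P.gL) = Ring.inverse P.gR := by
  rw [P.W.S_inverse P.gL_unit, ← P.gR_S]

theorem S_inv_gR : P.W.S (Ring.inverse P.gR) = Ring.inverse P.gL := by
  rw [P.W.S_inverse P.gR_unit, S_gR]

theorem Δ_gL_mul (y : A) : P.W.Δ (P.gL * y) = (P.gL ⊗ₜ[ℂ] 1) * P.W.Δ y := by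
  obtain ⟨b, hb⟩ := P.gL_mem
  rw [P.W.Δ_mul, ← hb, P.W.Δ_εL, mul_assoc, P.W.Δ_one_mul]

theorem Δ_mul_gL (y : A) : P.W.Δ (y * P.gL) = P.W.Δ y * (P.gL ⊗ₜ[ℂ] 1) := by
  obtain ⟨b, hb⟩ := P.gL_mem
  rw [P.W.Δ_mul, ← hb, P.W.Δ_εL', ← mul_assoc, P.W.Δ_mul_one]

theorem Δ_inv_gL_mul (y : A) :
    P.W.Δ (Ring.inverse P.gL * y) = (Ring.inverse P.gL ⊗ₜ[ℂ] 1) * P.W.Δ y := by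
  have h := P.Δ_gL_mul (Ring.inverse P.gL * y)
  rw [← mul_assoc, P.gL_mul_inv, one_mul] at h
  rw [h, ← mul_assoc, Algebra.TensorProduct.tmul_mul_tmul, P.inv_mul_gL, one_mul,
    ← Algebra.TensorProduct.one_def, one_mul]

theorem Δ_inv_gL_sq_mul (y : A) :
    P.W.Δ (Ring.inverse P.gL * Ring.inverse P.gL * y)
      = ((Ring.inverse P.gL * Ring.inverse P.gL) ⊗ₜ[ℂ] 1) * P.W.Δ y := by
  rw [mul_assoc, Δ_inv_gL_mul, Δ_inv_gL_mul, ← mul_assoc, Algebra.TensorProduct.tmul_mul_tmul,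
    one_mul]

/-- `⟨ĥ, x h₍₂₎⟩ h₍₁₎ = S(x) g_L²`. -/
theorem rapp_hHat_mul_Δ_h (x : A) :
    rapp P.hHat ((1 ⊗ₜ[ℂ] x) * P.W.Δ P.h) = P.W.S x * (P.gL * P.gL) := by
  rw [P.W.one_tmul_mul_Δ_of_left_integral P.haar_left, rapp_tmul_one_mul, P.gL_sq]

/-- `⟨ĥ, h₍₁₎ x⟩ h₍₂₎ = g_R² S(x)`. -/
theorem lapp_hHat_Δ_h_mul (x : A) :
    lapp P.hHat (P.W.Δ P.h * (x ⊗ₜ[ℂ] 1)) = P.gR * P.gR * P.W.S x := by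
  have key : ∀ t : A ⊗[ℂ] A, lapp P.hHat (TensorProduct.comm ℂ A A
      (TensorProduct.map P.W.S.toLinearMap P.W.S.toLinearMap t) * (x ⊗ₜ[ℂ] 1))
      = P.W.S (rapp P.hHat ((1 ⊗ₜ[ℂ] P.W.S.symm x) * t)) := by
    intro t
    induction t using TensorProduct.induction_on with
    | zero => simp
    | add y z hy hz => simp only [add_mul, mul_add, map_add, hy, hz]
    | tmul p q =>
      have : P.hHat (P.W.S q * x) = P.hHat (P.W.S.symm x * q) := by
        rw [← P.hHat_S (P.W.S.symm x * q), P.W.S_antimul, LinearEquiv.apply_symm_apply]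
      simp [this]
  rw [← P.haar_S, P.W.S_anticomul, key, rapp_hHat_mul_Δ_h, LinearEquiv.apply_symm_apply,
    P.W.S_antimul, P.W.S_antimul, ← P.gR_S]

/-- `⟨ĥ, x h₍₁₎⟩ h₍₂₎ = g⁻¹ S(x) g_L² g⁻¹`. -/
theorem lapp_hHat_mul_Δ_h (x : A) :
    lapp P.hHat ((x ⊗ₜ[ℂ] 1) * P.W.Δ P.h) = P.gR * Ring.inverse P.gL *
      (P.W.S x * (P.gL * P.gL)) * (P.gR * Ring.inverse P.gL) := by
  have h1 : ∀ t : A ⊗[ℂ] A, rapp P.hHat ((1 ⊗ₜ[ℂ] x) * t)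
      = lapp P.hHat ((x ⊗ₜ[ℂ] 1) * TensorProduct.comm ℂ A A t) := by
    intro t
    induction t using TensorProduct.induction_on with
    | zero => simp
    | add y z hy hz => simp only [mul_add, map_add, hy, hz]
    | tmul p q => simp
  have h2 : ∀ (c : A) (t : A ⊗[ℂ] A), lapp P.hHat ((x ⊗ₜ[ℂ] 1) * TensorProduct.map LinearMap.id
      (LinearMap.mulLeft ℂ c ∘ₗ LinearMap.mulRight ℂ c) t)
      = c * lapp P.hHat ((x ⊗ₜ[ℂ] 1) * t) * c := by
    intro c t
    induction t using TensorProduct.induction_on with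
    | zero => simp
    | add y z hy hz => simp only [mul_add, add_mul, map_add, hy, hz]
    | tmul p q => simp [mul_assoc]
  have h3 := P.rapp_hHat_mul_Δ_h x
  rw [h1, ← P.haar_flip, h2] at h3
  have h4 : ∀ c X : A, IsUnit c → Ring.inverse c * (c * X * c) * Ring.inverse c = X := by
    intro c X hc
    rw [mul_assoc c, ← mul_assoc (Ring.inverse c) c, Ring.inverse_mul_cancel c hc, one_mul,
      mul_assoc, Ring.mul_inverse_cancel c hc, mul_one]
  rw [← h3, ← inverse_gL_mul_inverse_gR]
  exact (h4 _ _ P.g_unit).symm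

theorem S_gL_mul_gR : P.W.S (P.gL * P.gR) = P.gL * P.gR := by
  rw [P.W.S_antimul, S_gR, ← P.gR_S]

theorem S_inv_gL_mul_inv_gR : P.W.S (Ring.inverse P.gL * Ring.inverse P.gR)
    = Ring.inverse P.gL * Ring.inverse P.gR := by
  rw [P.W.S_antimul, S_inv_gR, S_inv_gL]

/-- The modular automorphism of `ĥ` is implemented by `g_L g_R`. -/
theorem hHat_mul (x a : A) : P.hHat (x * a) = P.hHat (a * (P.gL * P.gR * x *
    (Ring.inverse P.gL * Ring.inverse P.gR))) := by
  obtain ⟨-, ψ, -, rfl⟩ := P.haar_nondeg a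
  have h1 : ∀ t : A ⊗[ℂ] A, P.hHat (x * rapp ψ t) = ψ (lapp P.hHat ((x ⊗ₜ[ℂ] 1) * t)) := by
    intro t
    induction t using TensorProduct.induction_on with
    | zero => simp
    | add y z hy hz => simp only [mul_add, map_add, hy, hz]
    | tmul p q => simp [mul_comm]
  have h2 : ∀ (y : A) (t : A ⊗[ℂ] A),
      P.hHat (rapp ψ t * y) = ψ (lapp P.hHat (t * (y ⊗ₜ[ℂ] 1))) := by
    intro y t
    induction t using TensorProduct.induction_on with
    | zero => simp
    | add y z hy hz => simp only [add_mul, map_add, hy, hz]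
    | tmul p q => simp [mul_comm]
  rw [h1, h2, lapp_hHat_mul_Δ_h, lapp_hHat_Δ_h_mul,
    P.W.S_antimul _ (Ring.inverse P.gL * Ring.inverse P.gR), P.W.S_antimul (P.gL * P.gR) x,
    S_gL_mul_gR, S_inv_gL_mul_inv_gR]
  have e1 : P.gL * P.gL * (P.gR * Ring.inverse P.gL) = P.gL * P.gR := by
    rw [← P.commute_inv_gL_gR.eq, ← mul_assoc, mul_assoc P.gL P.gL, P.gL_mul_inv, mul_one]
  have e2 : P.gR * P.gR * (Ring.inverse P.gL * Ring.inverse P.gR) = P.gR * Ring.inverse P.gL := by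
    rw [P.commute_inv_gL_inv_gR.eq, ← mul_assoc, mul_assoc P.gR P.gR, P.gR_mul_inv, mul_one]
  congr 1
  rw [← mul_assoc (P.gR * P.gR), e2, mul_assoc (P.gR * Ring.inverse P.gL), mul_assoc (P.W.S x), e1]

/-- `x ↦ ⟨ĥ, g_L⁻¹ g_R⁻¹ x⟩` is a trace. -/
theorem hHat_inv_mul_mul_comm (x y : A) :
    P.hHat (Ring.inverse P.gL * Ring.inverse P.gR * (x * y))
      = P.hHat (Ring.inverse P.gL * Ring.inverse P.gR * (y * x)) := by
  have e : P.gL * P.gR * (Ring.inverse P.gL * Ring.inverse P.gR) = 1 := by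
    rw [P.commute_inv_gL_inv_gR.eq, ← mul_assoc, mul_assoc P.gL, P.gR_mul_inv, mul_one,
      P.gL_mul_inv]
  rw [← mul_assoc, P.hHat_mul, ← mul_assoc (P.gL * P.gR), e, one_mul,
    P.hHat_mul (Ring.inverse P.gL * Ring.inverse P.gR), e, one_mul, mul_assoc]

theorem hHat_inv_mul_eq (x : A) :
    P.hHat (Ring.inverse P.gL * Ring.inverse P.gR * x)
      = P.hHat (x * (Ring.inverse P.gL * Ring.inverse P.gR)) := by
  have e : P.gL * P.gR * (Ring.inverse P.gL * Ring.inverse P.gR) = 1 := by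
    rw [P.commute_inv_gL_inv_gR.eq, ← mul_assoc, mul_assoc P.gL, P.gR_mul_inv, mul_one,
      P.gL_mul_inv]
  rw [P.hHat_mul (Ring.inverse P.gL * Ring.inverse P.gR), e, one_mul]

theorem hHat_inv_mul_S (x : A) :
    P.hHat (Ring.inverse P.gL * Ring.inverse P.gR * P.W.S x)
      = P.hHat (Ring.inverse P.gL * Ring.inverse P.gR * x) := by
  rw [P.hHat_inv_mul_eq x, ← P.hHat_S (x * _), P.W.S_antimul, S_inv_gL_mul_inv_gR]

/-- `⟨ĥ, a b₍₂₎⟩ b₍₁₎ = S(a₍₁₎) ⟨ĥ, a₍₂₎ b⟩`. -/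
theorem rapp_hHat_mulLeft_Δ (a b : A) :
    rapp (P.hHat ∘ₗ LinearMap.mulLeft ℂ a) (P.W.Δ b)
      = rapp (P.hHat ∘ₗ LinearMap.mulRight ℂ b)
        (TensorProduct.map P.W.S.toLinearMap LinearMap.id (P.W.Δ a)) := by
  obtain ⟨φ, -, rfl, -⟩ := P.haar_nondeg b
  have h1 : ∀ t : A ⊗[ℂ] A, rapp (P.hHat ∘ₗ LinearMap.mulLeft ℂ a) (P.W.Δ (lapp φ t))
      = TensorProduct.lid ℂ A (TensorProduct.map φ (rapp (P.hHat ∘ₗ LinearMap.mulLeft ℂ a))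
        (TensorProduct.map LinearMap.id P.W.Δ t)) := by
    intro t
    induction t using TensorProduct.induction_on with
    | zero => simp
    | add y z hy hz => simp only [map_add, hy, hz]
    | tmul p q => simp
  have h2 : ∀ t : A ⊗[ℂ] A, TensorProduct.lid ℂ A (TensorProduct.map φ
      (rapp (P.hHat ∘ₗ LinearMap.mulLeft ℂ a)) (TensorProduct.assoc ℂ A A A
        (TensorProduct.map P.W.Δ LinearMap.id t)))
      = lapp φ (P.W.Δ (rapp P.hHat ((1 ⊗ₜ[ℂ] a) * t))) := by
    intro t
    induction t using TensorProduct.induction_on with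
    | zero => simp
    | add y z hy hz => simp only [mul_add, map_add, hy, hz]
    | tmul p q =>
      simp only [TensorProduct.map_tmul, Algebra.TensorProduct.tmul_mul_tmul, rapp_tmul, map_smul,
        one_mul]
      induction P.W.Δ p using TensorProduct.induction_on with
      | zero => simp
      | add y z hy hz => simp only [TensorProduct.add_tmul, smul_add, map_add, hy, hz]
      | tmul r s => simp [smul_smul, mul_comm]
  have h3 : ∀ (q : A) (t : A ⊗[ℂ] A),
      P.hHat (q * lapp φ t) = φ (rapp P.hHat ((1 ⊗ₜ[ℂ] q) * t)) := by
    intro q t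
    induction t using TensorProduct.induction_on with
    | zero => simp
    | add y z hy hz => simp only [mul_add, map_add, hy, hz]
    | tmul p q => simp [mul_comm]
  have h4 : ∀ d : A ⊗[ℂ] A, lapp φ (TensorProduct.comm ℂ A A
      (TensorProduct.map P.W.S.toLinearMap P.W.S.toLinearMap d) * ((P.gL * P.gL) ⊗ₜ[ℂ] 1))
      = rapp (P.hHat ∘ₗ LinearMap.mulRight ℂ (lapp φ (P.W.Δ P.h)))
        (TensorProduct.map P.W.S.toLinearMap LinearMap.id d) := by
    intro d
    induction d using TensorProduct.induction_on with
    | zero => simp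
    | add y z hy hz => simp only [add_mul, map_add, hy, hz]
    | tmul p q => simp [h3, rapp_hHat_mul_Δ_h]
  rw [h1, ← P.W.assoc_map_Δ, h2, rapp_hHat_mul_Δ_h, ← h4, ← P.W.S_anticomul, ← mul_assoc,
    Δ_mul_gL, Δ_mul_gL, mul_assoc, Algebra.TensorProduct.tmul_mul_tmul, one_mul]

/-- `⟨ĥ, a S(b₍₁₎)⟩ b₍₂₎ = a₍₁₎ ⟨ĥ, a₍₂₎ S(b)⟩`. -/
theorem lapp_hHat_mulLeft_S_Δ (a b : A) :
    lapp (P.hHat ∘ₗ LinearMap.mulLeft ℂ a ∘ₗ P.W.S.toLinearMap) (P.W.Δ b)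
      = rapp (P.hHat ∘ₗ LinearMap.mulRight ℂ (P.W.S b)) (P.W.Δ a) := by
  apply P.W.S.injective
  have h1 : ∀ t : A ⊗[ℂ] A,
      P.W.S (lapp (P.hHat ∘ₗ LinearMap.mulLeft ℂ a ∘ₗ P.W.S.toLinearMap) t)
      = rapp (P.hHat ∘ₗ LinearMap.mulLeft ℂ a) (TensorProduct.comm ℂ A A
        (TensorProduct.map P.W.S.toLinearMap P.W.S.toLinearMap t)) := by
    intro t
    induction t using TensorProduct.induction_on with
    | zero => simp
    | add y z hy hz => simp only [map_add, hy, hz]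
    | tmul p q => simp
  have h2 : ∀ (φ : A →ₗ[ℂ] ℂ) (t : A ⊗[ℂ] A), P.W.S (rapp φ t)
      = rapp φ (TensorProduct.map P.W.S.toLinearMap LinearMap.id t) := by
    intro φ t
    induction t using TensorProduct.induction_on with
    | zero => simp
    | add y z hy hz => simp only [map_add, hy, hz]
    | tmul p q => simp
  rw [h1, h2, ← P.W.S_anticomul, rapp_hHat_mulLeft_Δ]

/-- The functional `a ↦ ⟨ĥ, ε^L(a) g_R⁻²⟩`. -/
def jayFun : A →ₗ[ℂ] ℂ :=
  P.hHat ∘ₗ LinearMap.mulRight ℂ (Ring.inverse P.gR * Ring.inverse P.gR) ∘ₗ P.W.εL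

theorem jayFun_eq_εR (a : A) :
    P.jayFun a = P.hHat (Ring.inverse P.gL * Ring.inverse P.gL * P.W.εR a) := by
  have e2 : P.gR * Ring.inverse P.gL * (P.gL * Ring.inverse P.gR) = 1 := by
    rw [mul_assoc, ← mul_assoc (Ring.inverse P.gL), P.inv_mul_gL, one_mul, P.gR_mul_inv]
  have e3 : P.gL * Ring.inverse P.gR * (Ring.inverse P.gL * Ring.inverse P.gR)
      = Ring.inverse P.gR * Ring.inverse P.gR := by
    rw [P.commute_gL_inv_gR.eq, mul_assoc, ← mul_assoc P.gL, P.gL_mul_inv, one_mul]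
  have e4 : Ring.inverse P.gL * Ring.inverse P.gR * (P.gR * Ring.inverse P.gL)
      = Ring.inverse P.gL * Ring.inverse P.gL := by
    rw [mul_assoc, ← mul_assoc (Ring.inverse P.gR), P.inv_mul_gR, one_mul]
  have key : ∀ x y : A, P.hHat (x * P.W.S y * (Ring.inverse P.gR * Ring.inverse P.gR))
      = P.hHat (Ring.inverse P.gL * Ring.inverse P.gL * (P.W.S x * y)) := by
    intro x y
    have e5 : P.W.S y * (P.gL * Ring.inverse P.gR * x * (P.gR * Ring.inverse P.gL))
        * (P.gL * Ring.inverse P.gR) = P.W.S y * (P.gL * Ring.inverse P.gR * x) := by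
      rw [mul_assoc, mul_assoc (_ * x), e2, mul_one]
    rw [← e3, ← mul_assoc, ← hHat_inv_mul_eq, ← e4, mul_assoc _ (P.gR * _),
      ← P.hHat_inv_mul_S (P.gR * Ring.inverse P.gL * _), P.W.S_antimul, P.W.S_antimul (P.W.S x),
      S_S_apply, P.W.S_antimul P.gR, S_gR, S_inv_gL, ← P.commute_gL_inv_gR.eq, e5,
      hHat_inv_mul_mul_comm, P.hHat_inv_mul_mul_comm (P.W.S y), mul_assoc _ x]
  simp only [jayFun, WeakHopfData.εL, WeakHopfData.εR, LinearMap.comp_apply]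
  induction P.W.Δ a using TensorProduct.induction_on with
  | zero => simp
  | add y z hy hz => simp only [map_add, mul_add, hy, hz]
  | tmul p q => simpa [mul_assoc] using key p q

/-- The functional `⟨ĥ, ε^L(·) g_R⁻²⟩` is central in the dual algebra. -/
theorem rapp_jayFun_Δ (a : A) : rapp P.jayFun (P.W.Δ a) = lapp P.jayFun (P.W.Δ a) := by
  set θ : A ⊗[ℂ] A →ₗ[ℂ] ℂ := P.hHat ∘ₗ LinearMap.mul' ℂ A ∘ₗ TensorProduct.map LinearMap.id
    (P.W.S.toLinearMap ∘ₗ LinearMap.mulLeft ℂ (Ring.inverse P.gL * Ring.inverse P.gL)) with hθ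
  have hjay : P.jayFun = θ ∘ₗ P.W.Δ := by
    ext a
    simp only [jayFun, hθ, WeakHopfData.εL, LinearMap.comp_apply]
    induction P.W.Δ a using TensorProduct.induction_on with
    | zero => simp
    | add y z hy hz => simp only [map_add, hy, hz]
    | tmul p q => simp [P.W.S_antimul, S_inv_gL, mul_assoc]
  have h1 : ∀ t : A ⊗[ℂ] A, rapp P.jayFun t = TensorProduct.rid ℂ A
      (TensorProduct.map LinearMap.id θ (TensorProduct.map LinearMap.id P.W.Δ t)) := by
    intro t
    induction t using TensorProduct.induction_on with
    | zero => simp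
    | add y z hy hz => simp only [map_add, hy, hz]
    | tmul p q => simp [hjay]
  have h2 : ∀ t : A ⊗[ℂ] A, lapp P.jayFun t = TensorProduct.lid ℂ A
      (TensorProduct.map θ LinearMap.id (TensorProduct.map P.W.Δ LinearMap.id t)) := by
    intro t
    induction t using TensorProduct.induction_on with
    | zero => simp
    | add y z hy hz => simp only [map_add, hy, hz]
    | tmul p q => simp [hjay]
  have h3 : ∀ (q : A) (t : A ⊗[ℂ] A), TensorProduct.rid ℂ A
      (TensorProduct.map LinearMap.id θ (TensorProduct.assoc ℂ A A A (t ⊗ₜ[ℂ] q)))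
      = rapp (P.hHat ∘ₗ LinearMap.mulRight ℂ
        (P.W.S (Ring.inverse P.gL * Ring.inverse P.gL * q))) t := by
    intro q t
    induction t using TensorProduct.induction_on with
    | zero => simp
    | add y z hy hz => simp only [TensorProduct.add_tmul, map_add, hy, hz]
    | tmul r s => simp [hθ, mul_assoc]
  have h4 : ∀ (p : A) (t : A ⊗[ℂ] A), TensorProduct.lid ℂ A
      (TensorProduct.map θ LinearMap.id ((TensorProduct.assoc ℂ A A A).symm (p ⊗ₜ[ℂ] t)))
      = lapp (P.hHat ∘ₗ LinearMap.mulLeft ℂ p ∘ₗ P.W.S.toLinearMap)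
        (((Ring.inverse P.gL * Ring.inverse P.gL) ⊗ₜ[ℂ] 1) * t) := by
    intro q t
    induction t using TensorProduct.induction_on with
    | zero => simp
    | add y z hy hz => simp only [TensorProduct.tmul_add, mul_add, map_add, hy, hz]
    | tmul r s => simp [hθ, mul_assoc]
  have h5 : ∀ t : A ⊗[ℂ] A, TensorProduct.rid ℂ A (TensorProduct.map LinearMap.id θ
      (TensorProduct.assoc ℂ A A A (TensorProduct.map P.W.Δ LinearMap.id t)))
      = TensorProduct.lid ℂ A (TensorProduct.map θ LinearMap.id
        ((TensorProduct.assoc ℂ A A A).symm (TensorProduct.map LinearMap.id P.W.Δ t))) := by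
    intro t
    induction t using TensorProduct.induction_on with
    | zero => simp
    | add y z hy hz => simp only [map_add, hy, hz]
    | tmul p q =>
      simp only [TensorProduct.map_tmul, LinearMap.id_apply, h3, h4]
      rw [← Δ_inv_gL_sq_mul, lapp_hHat_mulLeft_S_Δ]
  rw [h1, h2, ← P.W.assoc_map_Δ, h5, ← P.W.assoc_map_Δ, LinearEquiv.symm_apply_apply]

theorem jayEl_eq : P.jayEl = lapp P.hHat
    (((Ring.inverse P.gL * Ring.inverse P.gL) ⊗ₜ[ℂ] 1) * P.W.Δ 1) := by
  rw [← Δ_inv_gL_sq_mul, mul_one]; rfl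

theorem hHat_S_mul_inv (p : A) :
    P.hHat (P.W.S p * (Ring.inverse P.gR * Ring.inverse P.gR))
      = P.hHat (Ring.inverse P.gL * Ring.inverse P.gL * p) := by
  rw [← P.hHat_S (Ring.inverse P.gL * Ring.inverse P.gL * p), P.W.S_antimul, P.W.S_antimul,
    S_inv_gL]

theorem lapp_jayFun_Δ (a : A) : lapp P.jayFun (P.W.Δ a) = P.jayEl * a := by
  have h1 : ∀ t : A ⊗[ℂ] A, lapp P.jayFun t
      = lapp (P.hHat ∘ₗ LinearMap.mulRight ℂ (Ring.inverse P.gR * Ring.inverse P.gR))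
        (TensorProduct.map P.W.εL LinearMap.id t) := by
    intro t
    induction t using TensorProduct.induction_on with
    | zero => simp
    | add y z hy hz => simp only [map_add, hy, hz]
    | tmul p q => simp [jayFun]
  have h2 : ∀ t : A ⊗[ℂ] A,
      lapp (P.hHat ∘ₗ LinearMap.mulRight ℂ (Ring.inverse P.gR * Ring.inverse P.gR))
        (TensorProduct.map P.W.S.toLinearMap LinearMap.id t)
      = lapp P.hHat (((Ring.inverse P.gL * Ring.inverse P.gL) ⊗ₜ[ℂ] 1) * t) := by
    intro t
    induction t using TensorProduct.induction_on with
    | zero => simp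
    | add y z hy hz => simp only [map_add, mul_add, hy, hz]
    | tmul p q => simp [hHat_S_mul_inv, mul_assoc]
  rw [h1, P.W.map_εL_id_Δ, lapp_mul_one_tmul, h2, jayEl_eq]

theorem lapp_jayFun_Δ' (a : A) : lapp P.jayFun (P.W.Δ a) = a * P.jayEl := by
  have h1 : ∀ t : A ⊗[ℂ] A, lapp P.jayFun t
      = lapp (P.hHat ∘ₗ LinearMap.mulLeft ℂ (Ring.inverse P.gL * Ring.inverse P.gL))
        (TensorProduct.map P.W.εR LinearMap.id t) := by
    intro t
    induction t using TensorProduct.induction_on with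
    | zero => simp
    | add y z hy hz => simp only [map_add, hy, hz]
    | tmul p q => simp [jayFun_eq_εR, mul_assoc]
  rw [h1, P.W.map_εR_id_Δ, lapp_one_tmul_mul, lapp_comp_mulLeft, jayEl_eq]

theorem rapp_jayFun_Δ_one : rapp P.jayFun (P.W.Δ 1) = P.W.S P.jayEl := by
  have h1 : ∀ t : A ⊗[ℂ] A, rapp P.jayFun t
      = rapp (P.hHat ∘ₗ LinearMap.mulRight ℂ (Ring.inverse P.gR * Ring.inverse P.gR))
        (TensorProduct.map LinearMap.id P.W.εL t) := by
    intro t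
    induction t using TensorProduct.induction_on with
    | zero => simp
    | add y z hy hz => simp only [map_add, hy, hz]
    | tmul p q => simp [jayFun]
  have h2 : ∀ t : A ⊗[ℂ] A,
      rapp (P.hHat ∘ₗ LinearMap.mulRight ℂ (Ring.inverse P.gR * Ring.inverse P.gR))
        (TensorProduct.comm ℂ A A (TensorProduct.map P.W.S.toLinearMap P.W.S.toLinearMap t))
      = P.W.S (lapp P.hHat (((Ring.inverse P.gL * Ring.inverse P.gL) ⊗ₜ[ℂ] 1) * t)) := by
    intro t
    induction t using TensorProduct.induction_on with
    | zero => simp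
    | add y z hy hz => simp only [map_add, mul_add, hy, hz]
    | tmul p q => simp [hHat_S_mul_inv, mul_assoc]
  rw [h1, P.W.map_id_εL_Δ, ← Algebra.TensorProduct.one_def, mul_one, jayEl_eq, ← h2,
    ← P.W.S_anticomul, P.W.S_one]

theorem S_jayEl : P.W.S P.jayEl = P.jayEl := by
  rw [← rapp_jayFun_Δ_one, rapp_jayFun_Δ, lapp_jayFun_Δ, mul_one]

theorem jayEl_commute (a : A) : Commute P.jayEl a := by
  rw [commute_iff_eq, ← lapp_jayFun_Δ, lapp_jayFun_Δ']

theorem inv_jayEl_commute (a : A) : Commute (Ring.inverse P.jayEl) a := by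
  by_cases hj : IsUnit P.jayEl
  · obtain ⟨u, hu⟩ := hj
    have := P.jayEl_commute a
    rw [← hu] at this ⊢
    rw [Ring.inverse_unit]
    exact this.units_inv_left
  · rw [Ring.inverse_non_unit _ hj]
    exact Commute.zero_left a

theorem S_inv_jayEl : P.W.S (Ring.inverse P.jayEl) = Ring.inverse P.jayEl := by
  by_cases hj : IsUnit P.jayEl
  · rw [P.W.S_inverse hj, S_jayEl]
  · rw [Ring.inverse_non_unit _ hj, map_zero]

theorem ω_apply (x : A) : P.ω x
    = P.hHat (Ring.inverse P.gL * Ring.inverse P.gR * (Ring.inverse P.jayEl * x)) := by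
  simp only [ω, LinearMap.comp_apply, LinearMap.mulLeft_apply]
  rw [(P.inv_jayEl_commute _).eq, mul_assoc]

theorem ω_mul_comm (x y : A) : P.ω (x * y) = P.ω (y * x) := by
  rw [ω_apply, ω_apply, ← mul_assoc (Ring.inverse P.jayEl), hHat_inv_mul_mul_comm,
    ← mul_assoc y, ← (P.inv_jayEl_commute y).eq, mul_assoc (Ring.inverse P.jayEl)]

theorem ω_S (x : A) : P.ω (P.W.S x) = P.ω x := by
  rw [ω_apply, ω_apply, ← P.hHat_inv_mul_S (_ * x), P.W.S_antimul, S_inv_jayEl,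
    (P.inv_jayEl_commute _).eq]

theorem ω_S_symm (x : A) : P.ω (P.W.S.symm x) = P.ω x := by
  rw [← ω_S, LinearEquiv.apply_symm_apply]

theorem ω_inverse_conj {r : A} (hr : IsUnit r) (x : A) : P.ω (Ring.inverse r * x * r) = P.ω x := by
  rw [ω_mul_comm, ← mul_assoc, Ring.mul_inverse_cancel r hr, one_mul]

theorem ω_conj_inverse {r : A} (hr : IsUnit r) (x : A) : P.ω (r * x * Ring.inverse r) = P.ω x := by
  rw [ω_mul_comm, ← mul_assoc, Ring.inverse_mul_cancel r hr, one_mul]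

theorem isUnit_sqrt_g : IsUnit (P.sqrt P.g) := by
  have h := P.g_unit
  rw [← P.sqrt_mul_self _ P.g_pos] at h
  exact ((Commute.refl _).isUnit_mul_iff.mp h).1

theorem JL_mul (x y : A) : P.JL (x * y) = P.JL y * P.JL x := by
  simp only [JL, P.W.S_antimul, mul_assoc]
  rw [← mul_assoc P.gL, P.gL_mul_inv, one_mul]

theorem JR_mul (x y : A) : P.JR (x * y) = P.JR y * P.JR x := by
  simp only [JR, P.W.S_symm_mul, mul_assoc]
  rw [← mul_assoc (Ring.inverse P.gL) P.gL, P.inv_mul_gL, one_mul]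

theorem JL_one : P.JL 1 = 1 := by
  rw [JL, P.W.S_one, mul_one, P.inv_mul_gL]

theorem JR_one : P.JR 1 = 1 := by
  rw [JR, P.W.S_symm_one, mul_one, P.gL_mul_inv]

theorem JL_JL (x : A) : P.JL (P.JL x) = x := by
  have e1 : Ring.inverse P.gL * (P.gR * (P.gL * Ring.inverse P.gR)) = 1 := by
    rw [P.commute_gL_inv_gR.eq, ← mul_assoc P.gR, P.gR_mul_inv, one_mul, P.inv_mul_gL]
  have e2 : P.gR * Ring.inverse P.gL * Ring.inverse P.gR * P.gL = 1 := by
    rw [mul_assoc, ← P.commute_gL_inv_gR.eq, mul_assoc, ← mul_assoc _ P.gL, P.inv_mul_gL, one_mul,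
      P.gR_mul_inv]
  calc P.JL (P.JL x) = Ring.inverse P.gL * (P.gR * (P.gL * Ring.inverse P.gR)) * x *
      (P.gR * Ring.inverse P.gL * Ring.inverse P.gR * P.gL) := by
        simp only [JL, P.W.S_antimul, S_S_apply, S_inv_gL, ← P.gR_S, mul_assoc]
    _ = x := by rw [e1, e2, one_mul, mul_one]

theorem S_JR (x : A) : P.W.S (P.JR x) = Ring.inverse P.gR * x * P.gR := by
  rw [JR, P.W.S_antimul, P.W.S_antimul, LinearEquiv.apply_symm_apply, S_inv_gL, ← P.gR_S,
    mul_assoc]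

theorem JR_JR (x : A) : P.JR (P.JR x) = x := by
  apply P.W.S.injective
  apply P.W.S.injective
  rw [S_JR, P.W.S_antimul, P.W.S_antimul, S_JR, S_gR, S_inv_gR, S_S_apply]
  simp only [mul_assoc]

end HaarPkg

/-- `J^L` and `J^R` are involutive unital algebra antihomomorphisms, and
`ω ∘ J = ω ∘ J^L = ω ∘ J^R = ω ∘ S = ω`. -/
theorem HaarPkg.JL_JR_antihomomorphisms {A : Type*} [NormedRing A] [StarRing A] [CStarRing A]
    [NormedAlgebra ℂ A] [StarModule ℂ A] [FiniteDimensional ℂ A]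
    (P : HaarPkg A) :
    (∀ x y : A, P.JL (x * y) = P.JL y * P.JL x) ∧ P.JL 1 = 1 ∧
    (∀ x : A, P.JL (P.JL x) = x) ∧
    (∀ x y : A, P.JR (x * y) = P.JR y * P.JR x) ∧ P.JR 1 = 1 ∧
    (∀ x : A, P.JR (P.JR x) = x) ∧
    (∀ x : A, P.ω (P.Jlin x) = P.ω x) ∧
    (∀ x : A, P.ω (P.JL x) = P.ω x) ∧
    (∀ x : A, P.ω (P.JR x) = P.ω x) ∧
    (∀ x : A, P.ω (P.W.S x) = P.ω x) := by
  refine ⟨P.JL_mul, P.JL_one, P.JL_JL, P.JR_mul, P.JR_one, P.JR_JR, fun x => ?_, fun x => ?_,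
    fun x => ?_, P.ω_S⟩
  · exact (P.ω_inverse_conj P.isUnit_sqrt_g _).trans (P.ω_S x)
  · exact (P.ω_inverse_conj P.gL_unit _).trans (P.ω_S x)
  · exact (P.ω_conj_inverse P.gL_unit _).trans (P.ω_S_symm x)

end
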